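/- Let P = (V,C,ν,σ) be a case of 3-SAT, let m_P be the associated midpoints structure on X, and let t be a tree realization of m_P. Then for every v ∈ [1,V] it is not the case that both τ_{v,1} > 0 and τ_{v,−1} > 0; indeed τ_{v,s} > 0 if and only if t(A_{v,s} ∪ A_{<v}) > 0, and at most one of t(A_{v,1} ∪ A_{<v}) > 0, t(A_{v,−1} ∪ A_{<v}) > 0 can hold. -/

import Mathlib

open Classical

/-- `sel S e` is `S¹ = S` for `e = true` and `Sᶜ = X∖S` for `e = false`. -/
def sel {X : Type*} (S : Set X) (e : Bool) : Set X := if e then S else Sᶜ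

/-- The closed interval `[S,T] = {U ⊆ X | S^e ⊆ U^g ⊆ T^f for some e, f, g ∈ {1,c}}`. -/
def icc {X : Type*} (S T : Set X) : Set (Set X) :=
  {U | ∃ e f g : Bool, sel S e ⊆ sel U g ∧ sel U g ⊆ sel T f}

/-- The half-open interval `[S,T) = [S,T] ∖ {T}`. -/
def ico {X : Type*} (S T : Set X) : Set (Set X) := icc S T \ {T}

/-- The open interval `(S,T) = [S,T] ∖ {S, Sᶜ, T, Tᶜ}`. -/
def ioo {X : Type*} (S T : Set X) : Set (Set X) := icc S T \ {S, Sᶜ, T, Tᶜ}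

/-- `t_W = Σ_{S ∈ W} t(S)` for a family `W` of subsets. -/
noncomputable def tW {X : Type*} (t : Set X → ℝ) (W : Set (Set X)) : ℝ :=
  ∑ᶠ U ∈ W, t U

/-- A midpoints structure on a linearly ordered set `X`, given as a symmetric map
assigning to each (unordered) pair `{x,y}` a subset `m x y ⊆ X` such that
`{x,y} ∩ m x y = {max x y}` for `x ≠ y`. -/
def IsMidpoints {X : Type*} [LinearOrder X] (m : X → X → Set X) : Prop :=
  (∀ x y : X, m x y = m y x) ∧
  (∀ x y : X, x ≠ y → ({x, y} : Set X) ∩ m x y = {max x y})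

/-- `t ∈ ℝ^{2^X}` is a tree realization of the midpoints structure `m`:
(1) `t(S) = t(Sᶜ) ≥ 0`; (2) if all four intersections `S^e ∩ T^f` are nonempty
then `t(S)·t(T) = 0`; (3) for `x ≠ x'`, `t_{[{x},m{x,x'}]} > t_{[{x'},m{x,x'})}`. -/
def IsTreeRealization {X : Type*} (m : X → X → Set X) (t : Set X → ℝ) : Prop :=
  (∀ S : Set X, t S = t Sᶜ ∧ 0 ≤ t S) ∧
  (∀ S T : Set X, (∀ e f : Bool, (sel S e ∩ sel T f).Nonempty) → t S * t T = 0) ∧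
  (∀ x x' : X, x ≠ x' → tW t (ico {x'} (m x x')) < tW t (icc {x} (m x x')))

/-! ## The 3-SAT encoding

A case of 3-SAT `P = (V,C,ν,σ)` is encoded with `ν : Fin C → Fin 3 → Fin (V+2)`
(the variable `ν c a ∈ [1,V]` of clause `c`, hypotheses `1 ≤ ν c a ≤ V` and
`ν c 0 < ν c 1 < ν c 2` are stated separately) and signs
`σ : Fin C → Fin 3 → Bool` (`true` for `+1`, `false` for `−1`). -/

/-- `X₀ = {x_{v,s} | v ∈ [0,V+1], s ∈ {−1,1}}`, with `x_{v,s}` encoded as `(v,s)`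
with `s : Bool` (`false` for `−1`, `true` for `+1`). -/
abbrev X₀ (V : ℕ) := Fin (V + 2) × Bool

/-- `Y = [0,3] × [0,3] × [−1,1]`, an element `(p,q,e)` encoded with
`e : Fin 3` (`0` for `−1`, `1` for `0`, `2` for `+1`). -/
abbrev Yc := Fin 4 × Fin 4 × Fin 3

/-- The underlying set `X = X₀ ∪ X₁ ∪ ⋯ ∪ X_C` of `m_P`, an element of `X_c`
(`c ∈ [1,C]`) encoded as `Sum.inr (c, (p,q,e))` with `c : Fin C`. -/
abbrev XP (V C : ℕ) := X₀ V ⊕ (Fin C × Yc)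

/-- The rank of `x_{v,s}` in the lexicographic order on `X₀`. -/
def key {V : ℕ} (x : X₀ V) : ℕ := 2 * (x.1 : ℕ) + (if x.2 then 1 else 0)

/-- The sign `s ∈ {−1,+1}` encoded by a Boolean. -/
def sgn (b : Bool) : ℤ := if b then 1 else -1

/-- The midpoints structure `m₀` on `X₀`: for `x_{v',s'} < x_{v,s}`,
`m₀{x_{v',s'},x_{v,s}} = {x_{u,r} | u ≥ v}` if `2v'+s' = 2v+s` and `v' < v`, and
`= {x_{v,s}}` if `2v'+s' < 2v+s`. -/
def m₀ {V : ℕ} (a b : X₀ V) : Set (X₀ V) :=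
  let big := if key a ≤ key b then b else a
  let small := if key a ≤ key b then a else b
  if 2 * (small.1 : ℤ) + sgn small.2 = 2 * (big.1 : ℤ) + sgn big.2 ∧ small.1 < big.1
  then {x : X₀ V | big.1 ≤ x.1}
  else {big}

/-- The rank of `(q,e)` in the total order
`(0,0)<(1,0)<(0,1)<(1,−1)<(2,0)<(1,1)<(2,−1)<(3,0)<(3,1)<(0,−1)<(2,1)<(3,−1)`
on `[0,3] × [−1,1]` (recall `e : Fin 3` encodes `e−1 ∈ [−1,1]`). -/
def qeRank (q : Fin 4) (e : Fin 3) : ℕ :=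
  match (q : ℕ), (e : ℕ) with
  | 0, 1 => 0
  | 1, 1 => 1
  | 0, 2 => 2
  | 1, 0 => 3
  | 2, 1 => 4
  | 1, 2 => 5
  | 2, 0 => 6
  | 3, 1 => 7
  | 3, 2 => 8
  | 0, 0 => 9
  | 2, 2 => 10
  | _, _ => 11

/-- The rank of `(p,q,e)` in the total order on `Y`:
`(p',q',e') < (p,q,e)` iff `p' < p`, or `p' = p` and `(q',e') < (q,e)`. -/
def yRank (y : Yc) : ℕ := 12 * (y.1 : ℕ) + qeRank y.2.1 y.2.2

/-- The involution `μ(p,q,e) = ((p+e) mod 4, (q+e) mod 4, −e)` on `Y`. -/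
def μY (y : Yc) : Yc :=
  if y.2.2 = 0 then (y.1 + 3, y.2.1 + 3, 2)
  else if y.2.2 = 2 then (y.1 + 1, y.2.1 + 1, 0)
  else y

/-- The condition under which the midpoint of `(p',q',e') < (p,q,e)` is the
singleton `{(p,q,e)}`: `p' < p`, or `p' = p` and `(q',e') < (q,0)`, or
`p' = p`, `q' = q`, `e' = 0` and `e = 1`. -/
def singleCond (small big : Yc) : Prop :=
  (small.1 : ℕ) < big.1 ∨
  (small.1 = big.1 ∧ qeRank small.2.1 small.2.2 < qeRank big.2.1 1) ∨
  (small.1 = big.1 ∧ small.2.1 = big.2.1 ∧ small.2.2 = 1 ∧ big.2.2 = 2)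

/-- The clause midpoints structure `m` on `Y`: for `(p',q',e') < (p,q,e)`,
`m{(p',q',e'),(p,q,e)} = {(p,q,e)}` under `singleCond`, and otherwise
`= {(p,q,e), μ(p,q,e)}`. -/
noncomputable def mY (a b : Yc) : Set Yc :=
  let big := if yRank a ≤ yRank b then b else a
  let small := if yRank a ≤ yRank b then a else b
  if singleCond small big then {big} else {big, μY big}

/-- The attaching map `f` on the clause part: `f(x_{c,p,q,e}) ∈ X₀` as in the paper
(`f(x_{c,p,a,0}) = x_{ν(c,a),−σ(c,a)}` for `a ∈ [0,2]`, `f(x_{c,p,3,0}) = x_{0,1}`,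
`f(x_{c,p,a,−1}) = f(x_{c,p,(a−1) mod 4,1}) = x_{ν(c,a),σ(c,a)}` for `a ∈ [0,2]`,
and `f(x_{c,p,3,−1}) = f(x_{c,p,2,1}) = x_{V+1,1}`). -/
def fcl {V C : ℕ} (ν : Fin C → Fin 3 → Fin (V + 2)) (σ : Fin C → Fin 3 → Bool)
    (w : Fin C × Yc) : X₀ V :=
  let c := w.1
  let q := w.2.2.1
  let e := w.2.2.2
  if e = 1 then
    -- e encodes 0
    if h : (q : ℕ) < 3 then (ν c ⟨q, h⟩, ! σ c ⟨q, h⟩)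
    else ((0 : Fin (V + 2)), true)
  else if e = 0 then
    -- e encodes −1
    if h : (q : ℕ) < 3 then (ν c ⟨q, h⟩, σ c ⟨q, h⟩)
    else (Fin.last (V + 1), true)
  else
    -- e encodes +1
    if h : (q : ℕ) + 1 < 3 then (ν c ⟨(q : ℕ) + 1, h⟩, σ c ⟨(q : ℕ) + 1, h⟩)
    else if q = 3 then (ν c 0, σ c 0)
    else (Fin.last (V + 1), true)

/-- The extension of `f` to all of `X` (`f` is the identity on `X₀`). -/
def fP {V C : ℕ} (ν : Fin C → Fin 3 → Fin (V + 2)) (σ : Fin C → Fin 3 → Bool) :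
    XP V C → X₀ V :=
  Sum.elim id (fcl ν σ)

/-- The midpoints structure `m_P` on `X`, obtained by combining `m₀` with a copy
`m_c` of `m` for each clause `c` along `f` (`m_{≤0} = m₀`,
`m_{≤c} = m_{≤(c−1)} ∪_{f|_{X_c}} m_c`, `m_P = m_{≤C}`), written out explicitly:
for `x, x' ∈ X₀` the midpoint is `m₀{x,x'} ∪ f⁻¹(m₀{x,x'})`; for `x` in an earlier
part and `y ∈ X_c` it is `{y}`; and within one `X_c` it is the copy of `mY`. -/
noncomputable def mP (V C : ℕ) (ν : Fin C → Fin 3 → Fin (V + 2))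
    (σ : Fin C → Fin 3 → Bool) : XP V C → XP V C → Set (XP V C) :=
  fun z w =>
    match z, w with
    | Sum.inl a, Sum.inl b =>
        (Sum.inl '' m₀ a b) ∪ (Sum.inr '' {u : Fin C × Yc | fcl ν σ u ∈ m₀ a b})
    | Sum.inl _, Sum.inr y => {Sum.inr y}
    | Sum.inr y, Sum.inl _ => {Sum.inr y}
    | Sum.inr (c, y), Sum.inr (c', y') =>
        if c = c' then (fun u => (Sum.inr (c, u) : XP V C)) '' mY y y'
        else if c < c' then {Sum.inr (c', y')} else {Sum.inr (c, y)}

/-- `A_{v,s} = f⁻¹({x_{v,s}}) ⊆ X`. -/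
def Avs {V C : ℕ} (ν : Fin C → Fin 3 → Fin (V + 2)) (σ : Fin C → Fin 3 → Bool)
    (v : Fin (V + 2)) (s : Bool) : Set (XP V C) :=
  {z | fP ν σ z = (v, s)}

/-- `A_{>v} = f⁻¹({x_{v',s'} | v' > v}) ⊆ X`. -/
def Agt {V C : ℕ} (ν : Fin C → Fin 3 → Fin (V + 2)) (σ : Fin C → Fin 3 → Bool)
    (v : Fin (V + 2)) : Set (XP V C) :=
  {z | v < (fP ν σ z).1}

/-- `A_{<v} = f⁻¹({x_{v',s'} | v' < v}) ⊆ X`. -/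
def Alt {V C : ℕ} (ν : Fin C → Fin 3 → Fin (V + 2)) (σ : Fin C → Fin 3 → Bool)
    (v : Fin (V + 2)) : Set (XP V C) :=
  {z | (fP ν σ z).1 < v}

/-- `τ_{v,s} = t_{(A_{v,s},A_{v,−s})} − t_{(A_{v,−s},A_{>v})} + t_{(A_{>v},A_{<v})}
− t_{(A_{<v},A_{v,s})}`. -/
noncomputable def τP {V C : ℕ} (ν : Fin C → Fin 3 → Fin (V + 2))
    (σ : Fin C → Fin 3 → Bool) (t : Set (XP V C) → ℝ)
    (v : Fin (V + 2)) (s : Bool) : ℝ :=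
  tW t (ioo (Avs ν σ v s) (Avs ν σ v (! s)))
  - tW t (ioo (Avs ν σ v (! s)) (Agt ν σ v))
  + tW t (ioo (Agt ν σ v) (Alt ν σ v))
  - tW t (ioo (Alt ν σ v) (Avs ν σ v s))

lemma aux_icc_le {X : Type*} [Finite X] (t : Set X → ℝ) (h0 : ∀ S, 0 ≤ t S) (S T : Set X) :
    tW t (icc S T) ≤ tW t (ico S T) + t T := by
  by_cases hT : T ∈ icc S T
  · have h : icc S T = insert T (ico S T) := by
      unfold ico
      rw [Set.insert_sdiff_singleton, Set.insert_eq_of_mem hT]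
    have h2 : T ∉ ico S T := fun h => h.2 rfl
    have := finsum_mem_insert t h2 (Set.toFinite _)
    unfold tW
    rw [h, this]
    linarith
  · have h : ico S T = icc S T := by
      unfold ico
      exact Set.sdiff_singleton_eq_self hT
    rw [h]
    linarith [h0 T]

lemma aux_pos {X : Type*} [Finite X] {m : X → X → Set X} {t : Set X → ℝ}
    (ht : IsTreeRealization m t) {x x' : X} (M : Set X) (hx : x ≠ x')
    (h1 : m x x' = M) (h2 : m x' x = M) : 0 < t M := by
  obtain ⟨h, -, h3⟩ := ht
  have a := h3 x x' hx
  have b := h3 x' x hx.symm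
  rw [h1] at a
  rw [h2] at b
  have c := aux_icc_le t (fun S => (h S).2) {x} M
  have d := aux_icc_le t (fun S => (h S).2) {x'} M
  linarith

lemma aux_sum {X : Type*} {t : Set X → ℝ} (h1 : ∀ S : Set X, t S = t Sᶜ ∧ 0 ≤ t S)
    (h2 : ∀ S T : Set X, (∀ e f : Bool, (sel S e ∩ sel T f).Nonempty) → t S * t T = 0)
    (g : X → Fin 4) (hg : Function.Surjective g) (i j k l : Fin 4)
    (hij : i ≠ j) (hik : i ≠ k) (hil : i ≠ l) (hjk : j ≠ k) (hjl : j ≠ l) (hkl : k ≠ l)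
    (hk : 0 < t (g ⁻¹' {k})) (hl : 0 < t (g ⁻¹' {l})) :
    tW t (ioo (g ⁻¹' {i}) (g ⁻¹' {j})) =
      2 * t (g ⁻¹' {i, k}) + 2 * t (g ⁻¹' {i, l}) := by
  obtain ⟨xi, hxi⟩ := hg i
  obtain ⟨xj, hxj⟩ := hg j
  obtain ⟨xk, hxk⟩ := hg k
  obtain ⟨xl, hxl⟩ := hg l
  have cover : ∀ n : Fin 4, n = i ∨ n = j ∨ n = k ∨ n = l := by omega
  have c1 : (g ⁻¹' {i, k})ᶜ = g ⁻¹' {j, l} := by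
    ext x
    have := cover (g x)
    simp only [Set.mem_compl_iff, Set.mem_preimage, Set.mem_insert_iff, Set.mem_singleton_iff]
    omega
  have c2 : (g ⁻¹' {i, l})ᶜ = g ⁻¹' {j, k} := by
    ext x
    have := cover (g x)
    simp only [Set.mem_compl_iff, Set.mem_preimage, Set.mem_insert_iff, Set.mem_singleton_iff]
    omega
  -- classification of a normalized set
  have cls : ∀ U : Set X, t U ≠ 0 → xi ∈ U → xj ∉ U → ∀ n : Fin 4, 0 < t (g ⁻¹' {n}) →
      n ≠ i → n ≠ j → (∀ x, g x = n → x ∈ U) ∨ (∀ x, g x = n → x ∉ U) := by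
    intro U hU hi hj n hn hni hnj
    by_contra hcon
    push Not at hcon
    obtain ⟨⟨x, hx, hxU⟩, ⟨y, hy, hyU⟩⟩ := hcon
    have := h2 U (g ⁻¹' {n}) (by
      rintro (_ | _) (_ | _)
      · exact ⟨xj, by simpa [sel] using hj, by simp [sel, hxj, hnj.symm]⟩
      · exact ⟨x, by simpa [sel] using hxU, by simp [sel, hx]⟩
      · exact ⟨xi, by simpa [sel] using hi, by simp [sel, hxi, hni.symm]⟩
      · exact ⟨y, by simpa [sel] using hyU, by simp [sel, hy]⟩)
    rcases mul_eq_zero.1 this with h | h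
    · exact hU h
    · exact hn.ne' h
  have cls2 : ∀ U : Set X, t U ≠ 0 → g ⁻¹' {i} ⊆ U → U ⊆ (g ⁻¹' {j})ᶜ →
      U = g ⁻¹' {i} ∨ U = (g ⁻¹' {j})ᶜ ∨ U = g ⁻¹' {i, k} ∨ U = g ⁻¹' {i, l} := by
    intro U hU hi hj
    have hi' : ∀ x, g x = i → x ∈ U := fun x hx => hi hx
    have hj' : ∀ x, g x = j → x ∉ U := fun x hx hxU => hj hxU hx
    have hk' := cls U hU (hi' _ hxi) (hj' _ hxj) k hk hik.symm hjk.symm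
    have hl' := cls U hU (hi' _ hxi) (hj' _ hxj) l hl hil.symm hjl.symm
    rcases hk' with hk' | hk' <;> rcases hl' with hl' | hl'
    · right; left; ext x
      have := cover (g x)
      simp only [Set.mem_compl_iff, Set.mem_preimage, Set.mem_singleton_iff]
      grind
    · right; right; left; ext x
      have := cover (g x)
      simp only [Set.mem_preimage, Set.mem_singleton_iff, Set.mem_insert_iff]
      grind
    · right; right; right; ext x
      have := cover (g x)
      simp only [Set.mem_preimage, Set.mem_singleton_iff, Set.mem_insert_iff]
      grind
    · left; ext x
      have := cover (g x)
      simp only [Set.mem_preimage, Set.mem_singleton_iff]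
      grind
  have neq : ∀ (A B : Set (Fin 4)), A ≠ B → g ⁻¹' A ≠ g ⁻¹' B := fun A B h h' =>
    h (hg.preimage_injective h')
  have key0 : ioo (g ⁻¹' {i}) (g ⁻¹' {j}) ∩ Function.support t =
      ({g ⁻¹' {i, k}, g ⁻¹' {j, l}, g ⁻¹' {i, l}, g ⁻¹' {j, k}} : Set (Set X)) ∩
        Function.support t := by
    ext U
    simp only [Set.mem_inter_iff, Function.mem_support]
    constructor
    · rintro ⟨⟨⟨e, f, b, hs1, hs2⟩, hn⟩, hU⟩
      refine ⟨?_, hU⟩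
      simp only [Set.mem_insert_iff, Set.mem_singleton_iff, not_or] at hn
      obtain ⟨n1, n2, n3, n4⟩ := hn
      have hs := hs1.trans hs2
      have he : e = true ∧ f = false := by
        rcases e with _ | _ <;> rcases f with _ | _
        · exact absurd hxj (by
            have := @hs xj (by simp [sel, hxj, hij.symm])
            simpa [sel] using this)
        · exact absurd (@hs xk (by simp [sel, hxk, hik.symm])) (by simp [sel, hxk, hjk.symm])
        · simp
        · exact absurd (@hs xi (by simp [sel, hxi])) (by simp [sel, hxi, hij])
      obtain ⟨rfl, rfl⟩ := he
      simp only [sel, if_true, Bool.false_eq_true, if_false] at hs1 hs2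
      rcases b with _ | _
      · simp only [Bool.false_eq_true, if_false] at hs1 hs2
        rcases cls2 Uᶜ (by rwa [← (h1 U).1]) hs1 hs2 with h | h | h | h
        · exact absurd (compl_eq_comm.1 h).symm n2
        · exact absurd (compl_injective h) n3
        · right; left; rw [← c1, ← h, compl_compl]
        · right; right; right; rw [Set.mem_singleton_iff, ← c2, ← h, compl_compl]
      · simp only [if_true] at hs1 hs2
        rcases cls2 U hU hs1 hs2 with h | h | h | h
        · exact absurd h n1
        · exact absurd h n4
        · left; exact h
        · right; right; left; exact h
    · rintro ⟨h, hU⟩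
      refine ⟨?_, hU⟩
      simp only [Set.mem_insert_iff, Set.mem_singleton_iff] at h
      constructor
      · rcases h with rfl | rfl | rfl | rfl
        · refine ⟨true, false, true, ?_, ?_⟩ <;> intro x <;> simp [sel] <;> omega
        · refine ⟨true, false, false, ?_, ?_⟩ <;> intro x <;> simp [sel] <;> omega
        · refine ⟨true, false, true, ?_, ?_⟩ <;> intro x <;> simp [sel] <;> omega
        · refine ⟨true, false, false, ?_, ?_⟩ <;> intro x <;> simp [sel] <;> omega
      · intro hm
        have mi := fun (W : Set X) (hW : U = W) => Set.ext_iff.1 hW xi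
        have mj := fun (W : Set X) (hW : U = W) => Set.ext_iff.1 hW xj
        have mk := fun (W : Set X) (hW : U = W) => Set.ext_iff.1 hW xk
        have ml := fun (W : Set X) (hW : U = W) => Set.ext_iff.1 hW xl
        simp only [Set.mem_insert_iff, Set.mem_singleton_iff] at hm
        rcases h with h | h | h | h <;> rcases hm with h' | h' | h' | h' <;>
        · have q1 := mi _ h
          have q2 := mj _ h
          have q3 := mk _ h
          have q4 := ml _ h
          have r1 := mi _ h'
          have r2 := mj _ h'
          have r3 := mk _ h'
          have r4 := ml _ h'
          simp only [Set.mem_compl_iff, Set.mem_preimage, Set.mem_insert_iff,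
            Set.mem_singleton_iff, hxi, hxj, hxk, hxl] at q1 q2 q3 q4 r1 r2 r3 r4
          grind
  unfold tW
  rw [← finsum_mem_inter_support, key0, finsum_mem_inter_support]
  have d : ∀ A B : Set (Fin 4), ∀ n : Fin 4, n ∈ A → n ∉ B → g ⁻¹' A ≠ g ⁻¹' B :=
    fun A B n h h' => neq A B (fun e => h' (e ▸ h))
  have d1 := d {i, k} {j, l} i (by simp) (by simp; omega)
  have d2 := d {i, k} {i, l} k (by simp) (by simp; omega)
  have d3 := d {i, k} {j, k} i (by simp) (by simp; omega)
  have d4 := d {j, l} {i, l} j (by simp) (by simp; omega)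
  have d5 := d {j, l} {j, k} l (by simp) (by simp; omega)
  have d6 := d {i, l} {j, k} i (by simp) (by simp; omega)
  rw [finsum_mem_insert _ (by simp [d1, d2, d3]) (Set.toFinite _),
    finsum_mem_insert _ (by simp [d4, d5]) (Set.toFinite _),
    finsum_mem_pair d6, ← c1, ← c2, ← (h1 _).1, ← (h1 _).1]
  ring

lemma aux_m0 {V C : ℕ} (ν : Fin C → Fin 3 → Fin (V + 2)) (σ : Fin C → Fin 3 → Bool)
    (a b : X₀ V) : mP V C ν σ (Sum.inl a) (Sum.inl b) = fP ν σ ⁻¹' (m₀ a b) := by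
  ext (x | x) <;> simp [mP, fP]

lemma aux_m0_lt {V : ℕ} (a b : X₀ V) (h : key a < key b) :
    m₀ b a = m₀ a b := by
  unfold m₀
  simp [h.le, not_le.2 h]

lemma aux_m0_pos {V C : ℕ} (ν : Fin C → Fin 3 → Fin (V + 2)) (σ : Fin C → Fin 3 → Bool)
    (t : Set (XP V C) → ℝ) (ht : IsTreeRealization (mP V C ν σ) t)
    (a b : X₀ V) (h : key a < key b) : 0 < t (fP ν σ ⁻¹' (m₀ a b)) := by
  refine aux_pos ht (x := Sum.inl a) (x' := Sum.inl b) _ ?_ (aux_m0 ν σ a b) ?_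
  · intro e
    rw [Sum.inl.inj e] at h
    exact lt_irrefl _ h
  · rw [aux_m0, aux_m0_lt a b h]

/-- If `t` is a tree realization of `m_P`, then for every `v ∈ [1,V]` it is not the
case that both `τ_{v,1} > 0` and `τ_{v,−1} > 0`; indeed `τ_{v,s} > 0` iff
`t(A_{v,s} ∪ A_{<v}) > 0`, and at most one of `t(A_{v,1} ∪ A_{<v}) > 0`,
`t(A_{v,−1} ∪ A_{<v}) > 0` can hold. -/
theorem tau_pos_iff_and_exclusive (V C : ℕ) (ν : Fin C → Fin 3 → Fin (V + 2))
    (σ : Fin C → Fin 3 → Bool)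
    (hrange : ∀ c a, 1 ≤ (ν c a : ℕ) ∧ (ν c a : ℕ) ≤ V)
    (hmono : ∀ c, (ν c 0 : ℕ) < (ν c 1 : ℕ) ∧ (ν c 1 : ℕ) < (ν c 2 : ℕ))
    (t : Set (XP V C) → ℝ) (ht : IsTreeRealization (mP V C ν σ) t) :
    ∀ v : Fin (V + 2), 1 ≤ (v : ℕ) → (v : ℕ) ≤ V →
      (¬ (0 < τP ν σ t v true ∧ 0 < τP ν σ t v false)) ∧
      (∀ s : Bool, 0 < τP ν σ t v s ↔ 0 < t (Avs ν σ v s ∪ Alt ν σ v)) ∧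
      (¬ (0 < t (Avs ν σ v true ∪ Alt ν σ v) ∧
          0 < t (Avs ν σ v false ∪ Alt ν σ v))) := by
  intro v hv1 hv2
  obtain ⟨h1, h2, -⟩ := id ht
  have pA : ∀ s, 0 < t (Avs ν σ v s) := by
    intro s
    have := aux_m0_pos ν σ t ht (0, false) (v, s) (by
      unfold key; dsimp only; rw [Fin.val_zero]; split_ifs <;> first | omega | contradiction)
    have e : m₀ ((0, false) : X₀ V) (v, s) = {(v, s)} := by
      unfold m₀
      have : key ((0, false) : X₀ V) ≤ key (v, s) := by simp [key]
      simp only [this, if_true]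
      rw [if_neg]
      cases s <;> simp [sgn] <;> omega
    rw [e] at this
    exact this
  have pge : ∀ w : Fin (V + 2), 1 ≤ (w : ℕ) → 0 < t {z | w ≤ (fP ν σ z).1} := by
    intro w hw
    have hk : key (((⟨w - 1, by omega⟩, true)) : X₀ V) < key ((w, false) : X₀ V) := by
      simp [key]; omega
    have := aux_m0_pos ν σ t ht (⟨w - 1, by omega⟩, true) (w, false) hk
    have e : m₀ (((⟨w - 1, by omega⟩, true)) : X₀ V) (w, false) = {x | w ≤ x.1} := by
      unfold m₀
      simp only [hk.le, if_true]
      rw [if_pos]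
      refine ⟨?_, ?_⟩
      · simp [sgn]; omega
      · show (w : ℕ) - 1 < w; omega
    rw [e] at this
    exact this
  have pgt : 0 < t (Agt ν σ v) := by
    have := pge ⟨v + 1, by omega⟩ (by simp)
    exact this
  have plt : 0 < t (Alt ν σ v) := by
    have := pge v hv1
    rw [(h1 _).1] at this
    convert this using 2
    ext z
    simp [Alt]
  -- the four blocks
  have main : ∀ s : Bool, τP ν σ t v s =
      4 * (t (Avs ν σ v s ∪ Alt ν σ v) - t (Avs ν σ v s ∪ Avs ν σ v (!s))) ∧
      t (Avs ν σ v s ∪ Alt ν σ v) * t (Avs ν σ v s ∪ Avs ν σ v (!s)) = 0 ∧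
      t (Avs ν σ v s ∪ Alt ν σ v) * t (Avs ν σ v (!s) ∪ Alt ν σ v) = 0 := by
    intro s
    let g : XP V C → Fin 4 := fun z =>
      if fP ν σ z = (v, s) then 0 else if fP ν σ z = (v, !s) then 1
      else if v < (fP ν σ z).1 then 2 else 3
    have e0 : Avs ν σ v s = g ⁻¹' {0} := by
      ext z
      simp only [Avs, Set.mem_ofPred_eq, Set.mem_preimage, Set.mem_singleton_iff, g]
      split_ifs with a b c
      · simp [a]
      · simp [a, b]
      · simp [a, b, c]
      · simp [a, b, c]
    have e1 : Avs ν σ v (!s) = g ⁻¹' {1} := by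
      ext z
      simp only [Avs, Set.mem_ofPred_eq, Set.mem_preimage, Set.mem_singleton_iff, g]
      split_ifs with a b c
      · simp [a]
      · simp [a, b]
      · simp [a, b, c]
      · simp [a, b, c]
    have e2 : Agt ν σ v = g ⁻¹' {2} := by
      ext z
      simp only [Agt, Set.mem_ofPred_eq, Set.mem_preimage, Set.mem_singleton_iff, g]
      split_ifs with a b c
      · simp [a]
      · simp [a, b]
      · simp [a, b, c]
      · simp [a, b, c]
    have e3 : Alt ν σ v = g ⁻¹' {3} := by
      ext z
      simp only [Alt, Set.mem_ofPred_eq, Set.mem_preimage, Set.mem_singleton_iff, g]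
      split_ifs with h h' h''
      · simp [h]
      · simp [h']
      · simpa using h''.le
      · simp only [iff_true]
        refine lt_of_le_of_ne (not_lt.1 h'') ?_
        intro e
        rcases hz : fP ν σ z with ⟨u, r⟩
        rw [hz] at h h' e
        simp only at e
        subst e
        cases r <;> cases s <;> first | exact h rfl | exact h' rfl
    have hg : Function.Surjective g := by
      have m0 : Sum.inl (v, s) ∈ g ⁻¹' {0} := by rw [← e0]; simp [Avs, fP]
      have m1 : Sum.inl (v, !s) ∈ g ⁻¹' {1} := by rw [← e1]; simp [Avs, fP]
      have m2 : Sum.inl (⟨v + 1, by omega⟩, s) ∈ g ⁻¹' {2} := by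
        rw [← e2]; show (v : ℕ) < v + 1; omega
      have m3 : Sum.inl (0, s) ∈ g ⁻¹' {3} := by
        rw [← e3]; show (0 : ℕ) < v; omega
      intro n
      fin_cases n
      exacts [⟨_, m0⟩, ⟨_, m1⟩, ⟨_, m2⟩, ⟨_, m3⟩]
    have p0 := pA s
    have p1 := pA (!s)
    unfold τP
    rw [e0] at p0
    rw [e1] at p1
    rw [e2] at pgt
    rw [e3] at plt
    rw [e0, e1, e2, e3]
    have S := aux_sum h1 h2 g hg
    rw [S 0 1 2 3 (by decide) (by decide) (by decide) (by decide) (by decide) (by decide) pgt plt,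
      S 1 2 0 3 (by decide) (by decide) (by decide) (by decide) (by decide) (by decide) p0 plt,
      S 2 3 0 1 (by decide) (by decide) (by decide) (by decide) (by decide) (by decide) p0 p1,
      S 3 0 1 2 (by decide) (by decide) (by decide) (by decide) (by decide) (by decide) p1 pgt]
    have hc : ∀ A B : Set (Fin 4), Aᶜ = B → t (g ⁻¹' A) = t (g ⁻¹' B) := by
      rintro A B rfl
      exact (h1 _).1
    have hcd : ∀ A B : Finset (Fin 4), Aᶜ = B → t (g ⁻¹' A) = t (g ⁻¹' B) := by
      rintro A B rfl
      rw [Finset.coe_compl]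
      exact (h1 _).1
    have q1 : t (g ⁻¹' {1, 3}) = t (g ⁻¹' {0, 2}) := by
      simpa using hcd {1, 3} {0, 2} (by decide)
    have q2 : t (g ⁻¹' {2, 1}) = t (g ⁻¹' {0, 3}) := by
      simpa using hcd {2, 1} {0, 3} (by decide)
    have q3 : t (g ⁻¹' {3, 2}) = t (g ⁻¹' {0, 1}) := by
      simpa using hcd {3, 2} {0, 1} (by decide)
    have q4 : ({1, 0} : Set (Fin 4)) = {0, 1} := Set.pair_comm _ _
    have q5 : ({2, 0} : Set (Fin 4)) = {0, 2} := Set.pair_comm _ _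
    have q6 : ({3, 1} : Set (Fin 4)) = {1, 3} := Set.pair_comm _ _
    have u : ∀ i j : Fin 4, g ⁻¹' {i} ∪ g ⁻¹' {j} = g ⁻¹' {i, j} := by
      intro i j
      rw [← Set.preimage_union]; rfl
    rw [u, u, u, q4, q5, q6, q1, q2, q3]
    obtain ⟨y0, hy0⟩ := hg 0
    obtain ⟨y1, hy1⟩ := hg 1
    obtain ⟨y2, hy2⟩ := hg 2
    obtain ⟨y3, hy3⟩ := hg 3
    refine ⟨by ring, ?_, ?_⟩
    · apply h2
      rintro (_ | _) (_ | _)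
      · exact ⟨y2, by simp [sel, hy2]⟩
      · exact ⟨y1, by simp [sel, hy1]⟩
      · exact ⟨y3, by simp [sel, hy3]⟩
      · exact ⟨y0, by simp [sel, hy0]⟩
    · apply h2
      rintro (_ | _) (_ | _)
      · exact ⟨y1, by simp [sel, hy1]⟩
      · exact ⟨y2, by simp [sel, hy2]⟩
      · exact ⟨y3, by simp [sel, hy3]⟩
      · exact ⟨y0, by simp [sel, hy0]⟩
  have iff1 : ∀ s : Bool, 0 < τP ν σ t v s ↔ 0 < t (Avs ν σ v s ∪ Alt ν σ v) := by
    intro s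
    obtain ⟨a, b, -⟩ := main s
    have n1 := (h1 (Avs ν σ v s ∪ Alt ν σ v)).2
    have n2 := (h1 (Avs ν σ v s ∪ Avs ν σ v (!s))).2
    rw [a]
    constructor
    · intro h
      linarith
    · intro h
      rcases mul_eq_zero.1 b with h' | h' <;> linarith
  have ex : ¬ (0 < t (Avs ν σ v true ∪ Alt ν σ v) ∧ 0 < t (Avs ν σ v false ∪ Alt ν σ v)) := by
    rintro ⟨a, b⟩
    exact (mul_pos a b).ne' (main true).2.2
  refine ⟨?_, iff1, ex⟩
  rw [iff1, iff1]
  exact ex
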